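/- For any suspension triplet (l, k, b) for (X_A, σ_A), the one-sided suspension S_{A,b}^{l,k} = X_{A,b}^ℝ/∼_{l,k}, equipped with the quotient topology, is a compact Hausdorff space. -/

import Mathlib

open scoped BigOperators NNReal

namespace OneSidedMarkov

variable {N M : ℕ}

/-- The matrix has entries in `{0, 1}`. -/
def IsZeroOne (A : Matrix (Fin N) (Fin N) ℤ) : Prop := ∀ i j, A i j = 0 ∨ A i j = 1

/-- The matrix is irreducible. -/
def IsIrreducible (A : Matrix (Fin N) (Fin N) ℤ) : Prop :=
  ∀ i j, ∃ m : ℕ, 0 < m ∧ (A ^ m) i j ≠ 0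

/-- The matrix is a permutation matrix. -/
def IsPermutationMatrix (A : Matrix (Fin N) (Fin N) ℤ) : Prop :=
  ∃ e : Equiv.Perm (Fin N), ∀ i j, A i j = if e i = j then 1 else 0

/-- The one-sided topological Markov shift space `X_A`. -/
abbrev Space (A : Matrix (Fin N) (Fin N) ℤ) : Type :=
  {x : ℕ → Fin N // ∀ n, A (x n) (x (n + 1)) = 1}

/-- The shift map `σ_A`. -/
def shift (A : Matrix (Fin N) (Fin N) ℤ) (x : Space A) : Space A :=
  ⟨fun n => x.1 (n + 1), fun n => x.2 (n + 1)⟩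

lemma continuous_shift (A : Matrix (Fin N) (Fin N) ℤ) : Continuous (shift A) := by
  apply Continuous.subtype_mk
  exact continuous_pi fun n => (continuous_apply (n + 1)).comp continuous_subtype_val

/-- The shift map as a continuous map. -/
def shiftMap (A : Matrix (Fin N) (Fin N) ℤ) : C(Space A, Space A) :=
  ⟨shift A, continuous_shift A⟩

/-- The coboundary subgroup `{ g - g ∘ σ_A }` of `C(X_A, ℤ)`. -/
def cobdySubgroup (A : Matrix (Fin N) (Fin N) ℤ) : AddSubgroup C(Space A, ℤ) :=
  AddSubgroup.closure {f | ∃ g : C(Space A, ℤ), f = g - g.comp (shiftMap A)}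

/-- The ordered cohomology group `H^A = C(X_A, ℤ)/{g - g∘σ_A}`. -/
abbrev Coh (A : Matrix (Fin N) (Fin N) ℤ) : Type :=
  C(Space A, ℤ) ⧸ cobdySubgroup A

/-- The class `[f] ∈ H^A`. -/
def cohClass (A : Matrix (Fin N) (Fin N) ℤ) (f : C(Space A, ℤ)) : Coh A :=
  QuotientAddGroup.mk f

/-- The positive cone `H^A_+`. -/
def CohPos (A : Matrix (Fin N) (Fin N) ℤ) : Set (Coh A) :=
  {c | ∃ f : C(Space A, ℤ), (∀ x, 0 ≤ f x) ∧ c = cohClass A f}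

/-- `u` is an order unit of `(H^A, H^A_+)`. -/
def IsOrderUnit (A : Matrix (Fin N) (Fin N) ℤ) (u : Coh A) : Prop :=
  u ∈ CohPos A ∧ ∀ g : Coh A, ∃ n : ℕ, 0 < n ∧ n • u - g ∈ CohPos A

/-- The data `(l, k, b)` of a suspension. -/
structure SuspData (A : Matrix (Fin N) (Fin N) ℤ) where
  l : C(Space A, ℝ)
  k : C(Space A, ℝ)
  b : C(Space A, ℝ)

/-- `c = l - k`. -/
def cFun {A : Matrix (Fin N) (Fin N) ℤ} (T : SuspData A) (x : Space A) : ℝ :=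
  T.l x - T.k x

/-- `(l, k, b)` is a suspension triplet for `(X_A, σ_A)`. -/
def IsSuspTriplet {A : Matrix (Fin N) (Fin N) ℤ} (T : SuspData A) : Prop :=
  (∀ x, 0 ≤ T.l x) ∧ (∀ x, 0 ≤ T.k x) ∧
  (∃ c : C(Space A, ℤ), (∀ x, (c x : ℝ) = cFun T x) ∧ IsOrderUnit A (cohClass A c)) ∧
  (∀ x, ∃ m : ℕ, T.l x - T.b x = m) ∧
  (∀ x, ∃ m : ℕ, T.k x - T.b (shift A x) = m)

/-- The space `X_{A,b}^ℝ = {(x, r) : r ≥ b(x)}`. -/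
abbrev BaseSpace {A : Matrix (Fin N) (Fin N) ℤ} (T : SuspData A) : Type :=
  {p : Space A × ℝ // T.b p.1 ≤ p.2}

/-- The elementary relation `(x, r) ∼ (σ_A(x), r - c(x))` for `r ≥ l(x)`. -/
def SuspRel {A : Matrix (Fin N) (Fin N) ℤ} (T : SuspData A)
    (p q : BaseSpace T) : Prop :=
  T.l p.1.1 ≤ p.1.2 ∧ q.1 = (shift A p.1.1, p.1.2 - cFun T p.1.1)

/-- The equivalence relation `∼_{l,k}` generated by `SuspRel`. -/
def suspSetoid {A : Matrix (Fin N) (Fin N) ℤ} (T : SuspData A) : Setoid (BaseSpace T) :=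
  ⟨Relation.EqvGen (SuspRel T), Relation.EqvGen.is_equivalence _⟩

/-- The one-sided suspension `S_{A,b}^{l,k}` with the quotient topology. -/
abbrev Susp {A : Matrix (Fin N) (Fin N) ℤ} (T : SuspData A) : Type :=
  Quotient (suspSetoid T)

/-- The class `[x, r]`. -/
def mkSusp {A : Matrix (Fin N) (Fin N) ℤ} (T : SuspData A) (p : BaseSpace T) : Susp T :=
  Quotient.mk (suspSetoid T) p

/-- The base map `x ↦ [x, b(x)]`. -/
def basePoint {A : Matrix (Fin N) (Fin N) ℤ} (T : SuspData A) (x : Space A) : Susp T :=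
  mkSusp T ⟨(x, T.b x), le_refl _⟩

/-- Translation by `t ≥ 0` on `X_{A,b}^ℝ`. -/
def shiftPt {A : Matrix (Fin N) (Fin N) ℤ} (T : SuspData A) (t : ℝ≥0)
    (p : BaseSpace T) : BaseSpace T :=
  ⟨(p.1.1, p.1.2 + t), le_trans p.2 (le_add_of_nonneg_right t.2)⟩

lemma suspRel_shiftPt {A : Matrix (Fin N) (Fin N) ℤ} (T : SuspData A) (t : ℝ≥0)
    {p q : BaseSpace T} (h : SuspRel T p q) : SuspRel T (shiftPt T t p) (shiftPt T t q) := by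
  obtain ⟨h1, h2⟩ := h
  refine ⟨le_trans h1 (le_add_of_nonneg_right t.2), ?_⟩
  show (q.1.1, q.1.2 + (t : ℝ)) = _
  rw [h2]
  show (shift A p.1.1, p.1.2 - cFun T p.1.1 + (t : ℝ))
      = (shift A p.1.1, p.1.2 + (t : ℝ) - cFun T p.1.1)
  congr 1
  ring

lemma eqvGen_map {α : Type*} {r r' : α → α → Prop} (f : α → α)
    (hf : ∀ a b, r a b → r' (f a) (f b)) :
    ∀ a b, Relation.EqvGen r a b → Relation.EqvGen r' (f a) (f b) := by
  intro a b h
  induction h with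
  | rel a b hab => exact Relation.EqvGen.rel _ _ (hf a b hab)
  | refl a => exact Relation.EqvGen.refl _
  | symm a b _ ih => exact Relation.EqvGen.symm _ _ ih
  | trans a b c _ _ ih1 ih2 => exact Relation.EqvGen.trans _ _ _ ih1 ih2

/-- The flow `φ_{A,t}([x, r]) = [x, r + t]`, `t ∈ ℝ_+`, on the one-sided suspension. -/
def flow {A : Matrix (Fin N) (Fin N) ℤ} (T : SuspData A) (t : ℝ≥0) :
    Susp T → Susp T :=
  Quotient.map' (shiftPt T t)
    (fun p q h => eqvGen_map (shiftPt T t) (fun _ _ hr => suspRel_shiftPt T t hr) p q h)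

/-- The standard suspension data `(1, 0, 0)`. -/
def stdData (A : Matrix (Fin N) (Fin N) ℤ) : SuspData A := ⟨1, 0, 0⟩

/-- The standard one-sided suspension `S_A^1`. -/
abbrev StdSusp (A : Matrix (Fin N) (Fin N) ℤ) : Type := Susp (stdData A)

/-- The standard base map `s_A(x) = [x, 0]`. -/
def stdBase (A : Matrix (Fin N) (Fin N) ℤ) : Space A → StdSusp A :=
  basePoint (stdData A)

/-- The orbit equations of a continuous orbit equivalence. -/
def OrbitEqFns (A : Matrix (Fin N) (Fin N) ℤ) (B : Matrix (Fin M) (Fin M) ℤ)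
    (h : Space A ≃ₜ Space B) (k1 l1 : C(Space A, ℕ)) (k2 l2 : C(Space B, ℕ)) : Prop :=
  (∀ x : Space A, (shift B)^[k1 x] (h (shift A x)) = (shift B)^[l1 x] (h x)) ∧
  (∀ y : Space B, (shift A)^[k2 y] (h.symm (shift B y)) = (shift A)^[l2 y] (h.symm y))

/-- `(X_A, σ_A)` and `(X_B, σ_B)` are continuously orbit equivalent. -/
def ContOrbitEquiv (A : Matrix (Fin N) (Fin N) ℤ) (B : Matrix (Fin M) (Fin M) ℤ) : Prop :=
  ∃ h : Space A ≃ₜ Space B, ∃ k1 l1 : C(Space A, ℕ), ∃ k2 l2 : C(Space B, ℕ),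
    OrbitEqFns A B h k1 l1 k2 l2

/-- One-sided flow equivalence via the homeomorphism `h`. -/
def FlowEquivVia (A : Matrix (Fin N) (Fin N) ℤ) (B : Matrix (Fin M) (Fin M) ℤ)
    (h : Space A ≃ₜ Space B) : Prop :=
  ∃ T₁ : SuspData A, IsSuspTriplet T₁ ∧ ∃ T₂ : SuspData B, IsSuspTriplet T₂ ∧
  ∃ Φ₁ : Susp T₁ → StdSusp B, Continuous Φ₁ ∧
  ∃ Φ₂ : Susp T₂ → StdSusp A, Continuous Φ₂ ∧
  (∀ (t : ℝ≥0) (p : Susp T₁), Φ₁ (flow T₁ t p) = flow (stdData B) t (Φ₁ p)) ∧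
  (∀ x : Space A, Φ₁ (basePoint T₁ x) = stdBase B (h x)) ∧
  (∀ (t : ℝ≥0) (q : Susp T₂), Φ₂ (flow T₂ t q) = flow (stdData A) t (Φ₂ q)) ∧
  (∀ y : Space B, Φ₂ (basePoint T₂ y) = stdBase A (h.symm y))

/-- `(X_A, σ_A)` and `(X_B, σ_B)` are one-sided flow equivalent. -/
def OneSidedFlowEquiv (A : Matrix (Fin N) (Fin N) ℤ) (B : Matrix (Fin M) (Fin M) ℤ) : Prop :=
  ∃ h : Space A ≃ₜ Space B, FlowEquivVia A B h

/-- `f^m(x) = Σ_{i<m} f(σ_A^i(x))` for integer-valued `f`. -/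
def birk (A : Matrix (Fin N) (Fin N) ℤ) (f : Space A → ℤ) (m : ℕ) (x : Space A) : ℤ :=
  ∑ i ∈ Finset.range m, f ((shift A)^[i] x)

/-- `f^m(x) = Σ_{i<m} f(σ_A^i(x))` for real-valued `f`. -/
def birkR (A : Matrix (Fin N) (Fin N) ℤ) (f : Space A → ℝ) (m : ℕ) (x : Space A) : ℝ :=
  ∑ i ∈ Finset.range m, f ((shift A)^[i] x)

/-- `f^m(x) = Σ_{i<m} f(σ_A^i(x))` for ℕ-valued `f`. -/
def birkN (A : Matrix (Fin N) (Fin N) ℤ) (f : Space A → ℕ) (m : ℕ) (x : Space A) : ℕ :=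
  ∑ i ∈ Finset.range m, f ((shift A)^[i] x)

/-- The map `Ψ_h` associated with a continuous orbit equivalence. -/
def psi (A : Matrix (Fin N) (Fin N) ℤ) (B : Matrix (Fin M) (Fin M) ℤ)
    (h : Space A → Space B) (l1 k1 : Space A → ℕ) (f : Space B → ℤ) :
    Space A → ℤ :=
  fun x => (∑ i ∈ Finset.range (l1 x), f ((shift B)^[i] (h x)))
    - ∑ j ∈ Finset.range (k1 x), f ((shift B)^[j] (h (shift A x)))

/-- The dynamical zeta function `ζ_{A,f}(s)` with potential `f`. -/
noncomputable def zeta (A : Matrix (Fin N) (Fin N) ℤ) (f : Space A → ℤ) (s : ℂ) : ℂ :=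
  Complex.exp (∑' n : ℕ, (1 / (n + 1 : ℂ)) *
    ∑' x : {x : Space A // (shift A)^[n + 1] x = x},
      Complex.exp (-s * ((birk A f (n + 1) x.1 : ℤ) : ℂ)))

/-- `γ` is a periodic orbit of `(X_A, σ_A)`. -/
def IsPerOrbit (A : Matrix (Fin N) (Fin N) ℤ) (γ : Set (Space A)) : Prop :=
  ∃ (x : Space A) (p : ℕ), 0 < p ∧ (shift A)^[p] x = x ∧
    (∀ q : ℕ, 0 < q → (shift A)^[q] x = x → p ≤ q) ∧
    γ = {y | ∃ i : ℕ, i < p ∧ y = (shift A)^[i] x}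

/-- `τ` is a primitive periodic orbit of the flow on the one-sided suspension. -/
def IsFlowOrbit {A : Matrix (Fin N) (Fin N) ℤ} (T : SuspData A) (τ : Set (Susp T)) : Prop :=
  ∃ u : Susp T, (∃ t : ℝ≥0, 0 < t ∧ flow T t u = u) ∧
    τ = Set.range (fun t : ℝ≥0 => flow T t u)

/-- `ℓ(u) = min { t > 0 : φ_{A,t}(u) = u }`. -/
noncomputable def pointLen {A : Matrix (Fin N) (Fin N) ℤ} (T : SuspData A) (u : Susp T) : ℝ≥0 :=
  sInf {t : ℝ≥0 | 0 < t ∧ flow T t u = u}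

/-- `ℓ(τ) = min { t > 0 : φ_{A,t}(u) = u for all u ∈ τ }`. -/
noncomputable def orbitLen {A : Matrix (Fin N) (Fin N) ℤ} (T : SuspData A)
    (τ : Set (Susp T)) : ℝ≥0 :=
  sInf {t : ℝ≥0 | 0 < t ∧ ∀ u ∈ τ, flow T t u = u}

variable {A : Matrix (Fin N) (Fin N) ℤ}

/-- The image of a compact Hausdorff space under a continuous closed surjection is Hausdorff. -/
lemma t2Space_of_isClosedMap {X Y : Type*} [TopologicalSpace X] [TopologicalSpace Y]
    [CompactSpace X] [T2Space X] {f : X → Y} (hf : Continuous f) (hcl : IsClosedMap f)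
    (hs : Function.Surjective f) : T2Space Y := by
  have hpt : ∀ y : Y, IsClosed ({y} : Set Y) := fun y => by
    obtain ⟨x, rfl⟩ := hs y
    simpa using hcl {x} isClosed_singleton
  refine ⟨fun y z hyz => ?_⟩
  have hd : Disjoint (f ⁻¹' {y}) (f ⁻¹' {z}) :=
    Disjoint.preimage f (Set.disjoint_singleton.2 hyz)
  obtain ⟨U, V, hU, hV, hyU, hzV, hUV⟩ :=
    normal_separation ((hpt y).preimage hf) ((hpt z).preimage hf) hd
  refine ⟨(f '' Uᶜ)ᶜ, (f '' Vᶜ)ᶜ, (hcl _ hU.isClosed_compl).isOpen_compl,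
    (hcl _ hV.isClosed_compl).isOpen_compl, ?_, ?_, ?_⟩
  · rintro ⟨x, hx, rfl⟩
    exact hx (hyU rfl)
  · rintro ⟨x, hx, rfl⟩
    exact hx (hzV rfl)
  · rw [Set.disjoint_left]
    intro w hw hw'
    obtain ⟨x, rfl⟩ := hs w
    have hxU : x ∈ U := by
      by_contra h
      exact hw ⟨x, h, rfl⟩
    have hxV : x ∈ V := by
      by_contra h
      exact hw' ⟨x, h, rfl⟩
    exact Set.disjoint_left.1 hUV hxU hxV

instance compactSpace_space : CompactSpace (Space A) := by
  refine isCompact_iff_compactSpace.1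
    (IsClosed.isCompact (s := {x : ℕ → Fin N | ∀ n, A (x n) (x (n + 1)) = 1}) ?_)
  rw [Set.ofPred_forall]
  refine isClosed_iInter fun n => ?_
  have hc : Continuous fun x : ℕ → Fin N => (x n, x (n + 1)) := by fun_prop
  exact (isClosed_discrete {p : Fin N × Fin N | A p.1 p.2 = 1}).preimage hc

lemma exists_eq_of_mem_cobdySubgroup {f : C(Space A, ℤ)} (hf : f ∈ cobdySubgroup A) :
    ∃ g : C(Space A, ℤ), f = g - g.comp (shiftMap A) := by
  induction hf using AddSubgroup.closure_induction with
  | mem f h => exact h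
  | zero => exact ⟨0, by ext; simp⟩
  | add f f' _ _ h h' =>
    obtain ⟨g, rfl⟩ := h
    obtain ⟨g', rfl⟩ := h'
    exact ⟨g + g', by ext; simp; ring⟩
  | neg f _ h =>
    obtain ⟨g, rfl⟩ := h
    exact ⟨-g, by ext; simp; ring⟩

/-- The map `(x, r) ↦ (σ_A(x), r - c(x))` on all of `X_A × ℝ`. -/
def step (T : SuspData A) (p : Space A × ℝ) : Space A × ℝ :=
  (shift A p.1, p.2 - cFun T p.1)

lemma continuous_step (T : SuspData A) : Continuous (step T) := by
  have h := continuous_shift A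
  unfold step cFun
  fun_prop

/-- The first `m` steps from `p` are all permitted. -/
def CanStep (T : SuspData A) (m : ℕ) (p : Space A × ℝ) : Prop :=
  ∀ i < m, T.l ((step T)^[i] p).1 ≤ ((step T)^[i] p).2

lemma isClosed_canStep (T : SuspData A) (m : ℕ) : IsClosed {p | CanStep T m p} := by
  simp only [CanStep, Set.ofPred_forall]
  refine isClosed_iInter fun i => isClosed_iInter fun _ => ?_
  have h := (continuous_step T).iterate i
  exact isClosed_le (by fun_prop) (by fun_prop)

lemma canStep_add {T : SuspData A} {m n : ℕ} {p : Space A × ℝ} (h : CanStep T m p)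
    (h' : CanStep T n ((step T)^[m] p)) : CanStep T (m + n) p := by
  intro i hi
  by_cases him : i < m
  · exact h i him
  · have := h' (i - m) (by omega)
    rwa [← Function.iterate_add_apply, Nat.sub_add_cancel (by omega)] at this

lemma canStep_sub {T : SuspData A} {m n : ℕ} {p : Space A × ℝ} (h : CanStep T (m + n) p) :
    CanStep T n ((step T)^[m] p) := by
  intro i hi
  rw [← Function.iterate_add_apply]
  exact h _ (by omega)

/-- An order unit yields a continuous potential which every step decreases by at least one and
which is nonnegative wherever a step is permitted. -/
lemma exists_potential {T : SuspData A} (hT : IsSuspTriplet T) :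
    ∃ V : Space A × ℝ → ℝ, Continuous V ∧ (∀ p, V (step T p) ≤ V p - 1) ∧
      ∀ p, T.l p.1 ≤ p.2 → 0 ≤ V p := by
  obtain ⟨hl, -, ⟨c, hc, -, hu⟩, -, -⟩ := hT
  obtain ⟨n, -, f, hf, hnf⟩ := hu (cohClass A 1)
  have hmem : n • c - 1 - f ∈ cobdySubgroup A := by
    rw [← QuotientAddGroup.eq_zero_iff]
    exact sub_eq_zero.2 hnf
  obtain ⟨g, hg⟩ := exists_eq_of_mem_cobdySubgroup hmem
  have hgx : ∀ x, (n : ℝ) * cFun T x - 1 - f x = g x - g (shift A x) := fun x => by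
    have := DFunLike.congr_fun hg x
    simp only [ContinuousMap.sub_apply, ContinuousMap.one_apply,
      ContinuousMap.comp_apply, nsmul_eq_mul] at this
    rw [← hc]
    exact_mod_cast this
  have hgc : Continuous fun x => (g x : ℝ) := continuous_of_discreteTopology.comp g.continuous
  obtain ⟨G, hG⟩ := isCompact_univ.exists_bound_of_continuousOn hgc.continuousOn
  refine ⟨fun p => n * p.2 - g p.1 + G, ?_, fun p => ?_, fun p hp => ?_⟩
  · have := hgc.comp (continuous_fst (X := Space A) (Y := ℝ))
    simp only [Function.comp_def] at this
    fun_prop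
  · have h1 := hgx p.1
    have h2 : (0 : ℝ) ≤ f p.1 := by exact_mod_cast hf p.1
    simp only [step]
    linarith
  · have h1 := (abs_le.1 (hG p.1 trivial)).2
    have h2 : 0 ≤ (n : ℝ) * p.2 := mul_nonneg n.cast_nonneg ((hl _).trans hp)
    simp only
    linarith

lemma le_of_canStep {T : SuspData A} {V : Space A × ℝ → ℝ}
    (hV : ∀ p, V (step T p) ≤ V p - 1) (hV' : ∀ p, T.l p.1 ≤ p.2 → 0 ≤ V p)
    {m : ℕ} {p : Space A × ℝ} (h : CanStep T m p) : (m : ℝ) ≤ |V p| + 1 := by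
  have hit : ∀ i : ℕ, V ((step T)^[i] p) ≤ V p - i := by
    intro i
    induction i with
    | zero => simp
    | succ i ih =>
      rw [Function.iterate_succ_apply']
      push_cast
      linarith [hV ((step T)^[i] p)]
  rcases m with _ | m
  · simp only [Nat.cast_zero]
    positivity
  · have h1 := hV' _ (h m (Nat.lt_succ_self m))
    push_cast
    linarith [hit m, le_abs_self (V p)]

lemma step_mem {T : SuspData A} (hT : IsSuspTriplet T) {p : Space A × ℝ}
    (hp : T.l p.1 ≤ p.2) : T.b (step T p).1 ≤ (step T p).2 := by
  obtain ⟨-, -, -, -, hk⟩ := hT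
  obtain ⟨m, hm⟩ := hk p.1
  have h0 : (0 : ℝ) ≤ m := m.cast_nonneg
  simp only [step, cFun]
  linarith

/-- Permitted steps stay in the base space and inside one equivalence class. -/
lemma exists_eqvGen_of_canStep {T : SuspData A} (hT : IsSuspTriplet T) (p : BaseSpace T) {m : ℕ}
    (h : CanStep T m p.1) :
    ∃ q : BaseSpace T, q.1 = (step T)^[m] p.1 ∧ Relation.EqvGen (SuspRel T) p q := by
  induction m with
  | zero => exact ⟨p, rfl, .refl _⟩
  | succ m ih =>
    obtain ⟨q, hq, hpq⟩ := ih fun i hi => h i (by omega)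
    have hl := h m (by omega)
    rw [← hq] at hl
    refine ⟨⟨step T q.1, step_mem hT hl⟩, ?_, hpq.trans _ _ _ (.rel _ _ ⟨hl, rfl⟩)⟩
    rw [Function.iterate_succ_apply', ← hq]

/-- Two points are equivalent exactly when permitted steps lead them to a common point. -/
lemma eqvGen_iff {T : SuspData A} (hT : IsSuspTriplet T) (p q : BaseSpace T) :
    Relation.EqvGen (SuspRel T) p q ↔ ∃ m n : ℕ, CanStep T m p.1 ∧ CanStep T n q.1 ∧
      (step T)^[m] p.1 = (step T)^[n] q.1 := by
  constructor
  · intro h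
    induction h with
    | rel p q h =>
      refine ⟨1, 0, fun i hi => ?_, fun i hi => by omega, h.2.symm⟩
      obtain rfl : i = 0 := by omega
      exact h.1
    | refl p => exact ⟨0, 0, fun i hi => by omega, fun i hi => by omega, rfl⟩
    | symm p q _ ih =>
      obtain ⟨m, n, hm, hn, h⟩ := ih
      exact ⟨n, m, hn, hm, h.symm⟩
    | trans p q s _ _ ih ih' =>
      obtain ⟨m, n, hm, hn, h⟩ := ih
      obtain ⟨m', n', hm', hn', h'⟩ := ih'
      rcases le_total n m' with hle | hle
      · obtain ⟨d, rfl⟩ := Nat.exists_eq_add_of_le hle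
        refine ⟨m + d, n', canStep_add hm (h ▸ canStep_sub hm'), hn', ?_⟩
        rw [← h', Nat.add_comm m, Nat.add_comm n, Function.iterate_add_apply, h,
          Function.iterate_add_apply]
      · obtain ⟨d, rfl⟩ := Nat.exists_eq_add_of_le hle
        refine ⟨m, n' + d, hm, canStep_add hn' (h' ▸ canStep_sub hn), ?_⟩
        rw [h, Nat.add_comm m', Nat.add_comm n', Function.iterate_add_apply, h',
          Function.iterate_add_apply]
  · rintro ⟨m, n, hm, hn, h⟩
    obtain ⟨p', hp', hpp'⟩ := exists_eqvGen_of_canStep hT p hm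
    obtain ⟨q', hq', hqq'⟩ := exists_eqvGen_of_canStep hT q hn
    obtain rfl : p' = q' := Subtype.ext (by rw [hp', hq', h])
    exact hpp'.trans _ _ _ (hqq'.symm _ _)

lemma isClosed_eqvGen {T : SuspData A} (hT : IsSuspTriplet T) :
    IsClosed {pq : BaseSpace T × BaseSpace T | Relation.EqvGen (SuspRel T) pq.1 pq.2} := by
  obtain ⟨V, hVc, hV, hV'⟩ := exists_potential hT
  let E : ℕ × ℕ → Set (BaseSpace T × BaseSpace T) := fun mn =>
    {pq | CanStep T mn.1 pq.1.1 ∧ CanStep T mn.2 pq.2.1 ∧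
      (step T)^[mn.1] pq.1.1 = (step T)^[mn.2] pq.2.1}
  have hE : {pq : BaseSpace T × BaseSpace T | Relation.EqvGen (SuspRel T) pq.1 pq.2} =
      ⋃ mn, E mn := by
    ext pq
    simp [E, eqvGen_iff hT]
  rw [hE]
  refine LocallyFinite.isClosed_iUnion (fun pq => ?_) fun mn => ?_
  · obtain ⟨R, hR⟩ := exists_nat_gt (max |V pq.1.1| |V pq.2.1| + 1)
    refine ⟨{x | max |V x.1.1| |V x.2.1| + 1 < R},
      (isOpen_lt (by fun_prop) continuous_const).mem_nhds hR,
      (Set.finite_Iic (R, R)).subset ?_⟩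
    rintro ⟨m, n⟩ ⟨x, ⟨hm, hn, -⟩, hx⟩
    have h1 := le_of_canStep hV hV' hm
    have h2 := le_of_canStep hV hV' hn
    have h3 := le_max_left |V x.1.1| |V x.2.1|
    have h4 := le_max_right |V x.1.1| |V x.2.1|
    have hx' : max |V x.1.1| |V x.2.1| + 1 < R := hx
    have hmR : (m : ℝ) ≤ R := by simp only at h1; linarith
    have hnR : (n : ℝ) ≤ R := by simp only at h2; linarith
    exact ⟨by exact_mod_cast hmR, by exact_mod_cast hnR⟩
  · have h1 := (continuous_step T).iterate mn.1
    have h2 := (continuous_step T).iterate mn.2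
    exact ((isClosed_canStep T mn.1).preimage (by fun_prop)).inter
      (((isClosed_canStep T mn.2).preimage (by fun_prop)).inter
        (isClosed_eq (by fun_prop) (by fun_prop)))

/-- Every class has a representative at which no further step is permitted. -/
lemma exists_eqvGen_lt {T : SuspData A} (hT : IsSuspTriplet T) (p : BaseSpace T) :
    ∃ q : BaseSpace T, q.1.2 < T.l q.1.1 ∧ Relation.EqvGen (SuspRel T) p q := by
  obtain ⟨V, -, hV, hV'⟩ := exists_potential hT
  by_contra! hno
  have hall : ∀ m, CanStep T m p.1 := by
    intro m
    induction m with
    | zero => exact fun i hi => by omega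
    | succ m ih =>
      refine canStep_add ih fun i hi => ?_
      obtain rfl : i = 0 := by omega
      obtain ⟨q, hq, hpq⟩ := exists_eqvGen_of_canStep hT p ih
      by_contra! hlt
      refine hno q ?_ hpq
      rw [hq]
      exact hlt
  obtain ⟨m, hm⟩ := exists_nat_gt (|V p.1| + 1)
  exact absurd (le_of_canStep hV hV' (hall m)) (not_le.2 hm)

theorem susp_compactSpace_t2Space
    {N : ℕ} (A : Matrix (Fin N) (Fin N) ℤ)
    (hN : 1 < N) (hA01 : IsZeroOne A)
    (hAirr : IsIrreducible A) (hAnp : ¬ IsPermutationMatrix A)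
    (T : SuspData A) (hT : IsSuspTriplet T) :
    CompactSpace (Susp T) ∧ T2Space (Susp T) := by
  obtain ⟨L, hL⟩ := isCompact_univ.exists_bound_of_continuousOn (T.l - T.b).continuous.continuousOn
  let ι : Space A × Set.Icc (0 : ℝ) L → BaseSpace T := fun z =>
    ⟨(z.1, T.b z.1 + z.2), le_add_of_nonneg_right z.2.2.1⟩
  have hι : Continuous ι := by
    apply Continuous.subtype_mk
    fun_prop
  let π : Space A × Set.Icc (0 : ℝ) L → Susp T := fun z => mkSusp T (ι z)
  have hπ : Continuous π := continuous_quotient_mk'.comp hι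
  have hs : Function.Surjective π := by
    intro u
    obtain ⟨p, rfl⟩ := Quotient.exists_rep u
    obtain ⟨q, hq, hpq⟩ := exists_eqvGen_lt hT p
    have hb := q.2
    have hLq : T.l q.1.1 - T.b q.1.1 ≤ L := (abs_le.1 (hL q.1.1 trivial)).2
    refine ⟨(q.1.1, ⟨q.1.2 - T.b q.1.1, by linarith, by linarith⟩), ?_⟩
    have hιq : ι (q.1.1, ⟨q.1.2 - T.b q.1.1, by linarith, by linarith⟩) = q :=
      Subtype.ext (Prod.ext rfl (by simp [ι]))
    simp only [π, hιq]
    exact Quotient.sound (hpq.symm _ _)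
  have hcl : IsClosedMap π := by
    intro C hC
    rw [← isQuotientMap_quotient_mk'.isClosed_preimage]
    have hset : (Quotient.mk (suspSetoid T)) ⁻¹' (π '' C) = Prod.snd ''
        {zq : (Space A × Set.Icc (0 : ℝ) L) × BaseSpace T |
          zq.1 ∈ C ∧ Relation.EqvGen (SuspRel T) (ι zq.1) zq.2} := by
      ext q
      constructor
      · rintro ⟨z, hz, h⟩
        exact ⟨(z, q), ⟨hz, Quotient.exact h⟩, rfl⟩
      · rintro ⟨⟨z, q⟩, ⟨hz, h⟩, rfl⟩
        exact ⟨z, hz, Quotient.sound h⟩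
    refine hset ▸ isClosedMap_snd_of_compactSpace _ ((hC.preimage continuous_fst).inter ?_)
    exact (isClosed_eqvGen hT).preimage
      (f := fun zq : (Space A × Set.Icc (0 : ℝ) L) × BaseSpace T => (ι zq.1, zq.2)) (by fun_prop)
  exact ⟨hs.compactSpace hπ, t2Space_of_isClosedMap hπ hcl hs⟩

end OneSidedMarkov
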